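/- Let φ : ℝ^n → ℝ be continuous, bounded and nonnegative, and let f(x,t) = ∫_{ℝ^n} G(x-y,t) φ(y) dy where G is the Gauss–Weierstrass kernel. Then for every x ∈ ℝ^n and t > 0, |∇_x f(x,t)|²/f(x,t) ≤ ∂_t f(x,t) + (n/(2t)) f(x,t), where the inequality is interpreted to hold trivially when f(x,t)=0 (in which case f is identically zero). -/

import Mathlib

open MeasureTheory Real

lemma ly_gauss_int (n : ℕ) (x : EuclideanSpace ℝ (Fin n)) (b : ℝ) (hb : 0 < b) :
    Integrable (fun y : EuclideanSpace ℝ (Fin n) => Real.exp (-b * ‖x - y‖ ^ 2)) := by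
  have h := (GaussianFourier.integrable_cexp_neg_mul_sq_norm_add (V := EuclideanSpace ℝ (Fin n))
    (b := (b : ℂ)) (by simpa using hb) 0 0).norm
  have h2 : Integrable (fun y : EuclideanSpace ℝ (Fin n) => Real.exp (-b * ‖y‖ ^ 2)) := by
    refine h.congr (Filter.Eventually.of_forall fun y => ?_)
    simp only [Complex.norm_exp]
    congr 1
    simp [← Complex.ofReal_pow]
  exact h2.comp_sub_left x

lemma ly_poly (b u : ℝ) (hb : 0 < b) :
    (1 + u ^ 2) * Real.exp (-b * u ^ 2) ≤ (1 + 2 / b) * Real.exp (-(b / 2) * u ^ 2) := by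
  have e : Real.exp (-b * u ^ 2) = Real.exp (-(b / 2) * u ^ 2) * Real.exp (-(b / 2 * u ^ 2)) := by
    rw [← Real.exp_add]; congr 1; ring
  have h1 : 1 ≤ Real.exp (b / 2 * u ^ 2) := Real.one_le_exp (by positivity)
  have h2 : b / 2 * u ^ 2 ≤ Real.exp (b / 2 * u ^ 2) := by
    linarith [Real.add_one_le_exp (b / 2 * u ^ 2)]
  have h3 : 1 + u ^ 2 ≤ (1 + 2 / b) * Real.exp (b / 2 * u ^ 2) := by
    have : u ^ 2 = 2 / b * (b / 2 * u ^ 2) := by field_simp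
    have h4 : 2 / b * (b / 2 * u ^ 2) ≤ 2 / b * Real.exp (b / 2 * u ^ 2) := by gcongr
    linarith
  rw [e, Real.exp_neg]
  have hp := Real.exp_pos (b / 2 * u ^ 2)
  calc (1 + u ^ 2) * (Real.exp (-(b / 2) * u ^ 2) * (Real.exp (b / 2 * u ^ 2))⁻¹)
      ≤ ((1 + 2 / b) * Real.exp (b / 2 * u ^ 2)) *
        (Real.exp (-(b / 2) * u ^ 2) * (Real.exp (b / 2 * u ^ 2))⁻¹) := by gcongr
    _ = _ := by field_simp

lemma ly_int0 {n : ℕ} (φ : EuclideanSpace ℝ (Fin n) → ℝ) (hφc : Continuous φ) (M : ℝ)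
    (hM : ∀ x, |φ x| ≤ M) (x : EuclideanSpace ℝ (Fin n)) (t : ℝ) (ht : 0 < t) :
    Integrable (fun y => Real.exp (-‖x - y‖ ^ 2 / (4 * t)) * φ y) := by
  refine ((ly_gauss_int n x (1 / (4 * t)) (by positivity)).mul_const M).mono'
    (by fun_prop) (Filter.Eventually.of_forall fun y => ?_)
  rw [norm_mul, Real.norm_eq_abs, Real.norm_eq_abs, Real.abs_exp]
  have : -‖x - y‖ ^ 2 / (4 * t) = -(1 / (4 * t)) * ‖x - y‖ ^ 2 := by ring
  rw [this]
  gcongr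
  exact hM y

lemma ly_time {n : ℕ} (φ : EuclideanSpace ℝ (Fin n) → ℝ) (hφc : Continuous φ) (M : ℝ)
    (hM : ∀ x, |φ x| ≤ M) (x : EuclideanSpace ℝ (Fin n)) (t : ℝ) (ht : 0 < t) :
    Integrable (fun y => Real.exp (-‖x - y‖ ^ 2 / (4 * t)) * (‖x - y‖ ^ 2 / (4 * t ^ 2)) * φ y) ∧
    HasDerivAt (fun s => ∫ y, Real.exp (-‖x - y‖ ^ 2 / (4 * s)) * φ y)
      (∫ y, Real.exp (-‖x - y‖ ^ 2 / (4 * t)) * (‖x - y‖ ^ 2 / (4 * t ^ 2)) * φ y) t := by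
  refine hasDerivAt_integral_of_dominated_loc_of_deriv_le (s := Set.Ioo (t / 2) (2 * t))
    (F := fun s y => Real.exp (-‖x - y‖ ^ 2 / (4 * s)) * φ y)
    (F' := fun s y => Real.exp (-‖x - y‖ ^ 2 / (4 * s)) * (‖x - y‖ ^ 2 / (4 * s ^ 2)) * φ y)
    (bound := fun y => (1 + 2 / (1 / (8 * t))) *
      Real.exp (-((1 / (8 * t)) / 2) * ‖x - y‖ ^ 2) * (1 / t ^ 2) * M)
    (Ioo_mem_nhds (by linarith) (by linarith)) ?_ (ly_int0 φ hφc M hM x t ht) (by fun_prop) ?_ ?_ ?_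
  · exact Filter.Eventually.of_forall fun s => by fun_prop
  · refine Filter.Eventually.of_forall fun y s hs => ?_
    have hs0 : 0 < s := by linarith [hs.1]
    have hM0 : 0 ≤ M := (abs_nonneg _).trans (hM y)
    rw [norm_mul, norm_mul, Real.norm_eq_abs, Real.norm_eq_abs, Real.norm_eq_abs, Real.abs_exp,
      abs_of_nonneg (by positivity : 0 ≤ ‖x - y‖ ^ 2 / (4 * s ^ 2))]
    have h1 : -‖x - y‖ ^ 2 / (4 * s) ≤ -(1 / (8 * t)) * ‖x - y‖ ^ 2 := by
      have : ‖x - y‖ ^ 2 / (8 * t) ≤ ‖x - y‖ ^ 2 / (4 * s) := by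
        exact div_le_div_of_nonneg_left (by positivity) (by positivity) (by linarith [hs.2])
      calc _ = -(‖x - y‖ ^ 2 / (4 * s)) := by ring
        _ ≤ -(‖x - y‖ ^ 2 / (8 * t)) := by linarith
        _ = _ := by ring
    have h2 : ‖x - y‖ ^ 2 / (4 * s ^ 2) ≤ (1 + ‖x - y‖ ^ 2) * (1 / t ^ 2) := by
      rw [mul_one_div]
      gcongr
      · linarith
      · nlinarith [hs.1]
    calc _ ≤ Real.exp (-(1 / (8 * t)) * ‖x - y‖ ^ 2) * ((1 + ‖x - y‖ ^ 2) * (1 / t ^ 2)) * M := by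
          gcongr
          exact hM y
      _ = ((1 + ‖x - y‖ ^ 2) * Real.exp (-(1 / (8 * t)) * ‖x - y‖ ^ 2)) * (1 / t ^ 2) * M := by ring
      _ ≤ _ := by
          refine mul_le_mul_of_nonneg_right (mul_le_mul_of_nonneg_right
            (ly_poly _ _ (by positivity)) (by positivity)) (by positivity)
  · exact (((ly_gauss_int n x _ (by positivity)).const_mul _).mul_const _).mul_const _
  · refine Filter.Eventually.of_forall fun y s hs => ?_
    have hs0 : 0 < s := by linarith [hs.1]
    have h := (((hasDerivAt_inv hs0.ne').const_mul (-‖x - y‖ ^ 2 / 4)).exp).mul_const (φ y)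
    have e : ∀ r : ℝ, -‖x - y‖ ^ 2 / 4 * r⁻¹ = -‖x - y‖ ^ 2 / (4 * r) := by
      intro r; rw [div_mul_eq_div_div]; rfl
    simp only [e] at h
    refine h.congr_deriv ?_
    field_simp

lemma ly_space {n : ℕ} (φ : EuclideanSpace ℝ (Fin n) → ℝ) (hφc : Continuous φ) (M : ℝ)
    (hM : ∀ x, |φ x| ≤ M) (x : EuclideanSpace ℝ (Fin n)) (t : ℝ) (ht : 0 < t) :
    HasFDerivAt (fun x' => ∫ y, Real.exp (-‖x' - y‖ ^ 2 / (4 * t)) * φ y)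
      (∫ y, (Real.exp (-‖x - y‖ ^ 2 / (4 * t)) * φ y * (-(1 / (2 * t)))) •
        innerSL ℝ (x - y)) x := by
  refine hasFDerivAt_integral_of_dominated_of_fderiv_le (s := Metric.ball x 1)
    (F := fun x' y => Real.exp (-‖x' - y‖ ^ 2 / (4 * t)) * φ y)
    (F' := fun x y => (Real.exp (-‖x - y‖ ^ 2 / (4 * t)) * φ y * (-(1 / (2 * t)))) •
        innerSL ℝ (x - y))
    (bound := fun y => (1 + 2 / (1 / (4 * t))) * (Real.exp (1 / (8 * t)) *
      Real.exp (-(1 / (16 * t)) * ‖x - y‖ ^ 2)) * M * (1 / (2 * t)))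
    (Metric.ball_mem_nhds x one_pos) ?_ (ly_int0 φ hφc M hM x t ht) ?_ ?_ ?_ ?_
  · exact Filter.Eventually.of_forall fun s => by fun_prop
  · exact Continuous.aestronglyMeasurable (by fun_prop)
  · refine Filter.Eventually.of_forall fun y x' hx' => ?_
    have hM0 : 0 ≤ M := (abs_nonneg _).trans (hM y)
    rw [norm_smul, innerSL_apply_norm, norm_mul, norm_mul, norm_neg, Real.norm_eq_abs,
      Real.norm_eq_abs, Real.norm_eq_abs, Real.abs_exp,
      abs_of_nonneg (by positivity : 0 ≤ 1 / (2 * t))]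
    have h0 : ‖x' - y‖ ≤ 1 + ‖x' - y‖ ^ 2 := by nlinarith [sq_nonneg (‖x' - y‖ - 1)]
    have h1 : ‖x - y‖ ≤ ‖x' - y‖ + 1 := by
      have : ‖x - y‖ ≤ ‖x - x'‖ + ‖x' - y‖ := norm_sub_le_norm_sub_add_norm_sub x x' y
      have h2 : ‖x - x'‖ < 1 := by rw [← dist_eq_norm, dist_comm]; exact hx'
      linarith
    have h2 : ‖x - y‖ ^ 2 ≤ 2 * ‖x' - y‖ ^ 2 + 2 := by
      nlinarith [norm_nonneg (x - y), norm_nonneg (x' - y), sq_nonneg (‖x' - y‖ - 1)]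
    have h3 : -((1 / (4 * t)) / 2) * ‖x' - y‖ ^ 2 ≤
        1 / (8 * t) + -(1 / (16 * t)) * ‖x - y‖ ^ 2 := by
      have : 1 / (16 * t) * ‖x - y‖ ^ 2 ≤ 1 / (16 * t) * (2 * ‖x' - y‖ ^ 2 + 2) := by gcongr
      have e : 1 / (16 * t) * (2 * ‖x' - y‖ ^ 2 + 2) =
        ((1 / (4 * t)) / 2) * ‖x' - y‖ ^ 2 + 1 / (8 * t) := by field_simp; ring
      linarith
    calc _ ≤ Real.exp (-‖x' - y‖ ^ 2 / (4 * t)) * M * (1 / (2 * t)) * (1 + ‖x' - y‖ ^ 2) := by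
          gcongr
          exact hM y
      _ = ((1 + ‖x' - y‖ ^ 2) * Real.exp (-(1 / (4 * t)) * ‖x' - y‖ ^ 2)) * M * (1 / (2 * t)) := by
          have : -‖x' - y‖ ^ 2 / (4 * t) = -(1 / (4 * t)) * ‖x' - y‖ ^ 2 := by ring
          rw [this]; ring
      _ ≤ ((1 + 2 / (1 / (4 * t))) * Real.exp (-((1 / (4 * t)) / 2) * ‖x' - y‖ ^ 2)) *
            M * (1 / (2 * t)) := by
          refine mul_le_mul_of_nonneg_right (mul_le_mul_of_nonneg_right
            (ly_poly _ _ (by positivity)) (by positivity)) (by positivity)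
      _ ≤ _ := by
          rw [← Real.exp_add]
          gcongr
  · exact ((((ly_gauss_int n x _ (by positivity)).const_mul _).const_mul _).mul_const _).mul_const _
  · refine Filter.Eventually.of_forall fun y x' _ => ?_
    have h0 : HasFDerivAt (fun z : EuclideanSpace ℝ (Fin n) => z - y)
      (ContinuousLinearMap.id ℝ _) x' := (hasFDerivAt_id x').sub_const y
    have h := (((h0.norm_sq).const_mul (-(1 / (4 * t)))).exp).mul_const (φ y)
    have e : ∀ r : EuclideanSpace ℝ (Fin n),
        -(1 / (4 * t)) * ‖r - y‖ ^ 2 = -‖r - y‖ ^ 2 / (4 * t) := by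
      intro r; ring
    simp only [e] at h
    refine h.congr_fderiv ?_
    ext v
    simp
    ring

lemma ly_cs (A B C : ℝ) (hA : 0 ≤ A) (hC : 0 ≤ C) (h : ∀ s : ℝ, 0 ≤ C - 2 * s * B + s ^ 2 * A) :
    B ^ 2 / A ≤ C := by
  rcases hA.eq_or_lt with h0 | h0
  · rw [← h0]; simpa using hC
  · have := h (B / A)
    have e : C - 2 * (B / A) * B + (B / A) ^ 2 * A = C - B ^ 2 / A := by field_simp; ring
    linarith

/-- Li–Yau inequality for the heat semigroup on `ℝⁿ`: if `φ ≥ 0` is continuous and bounded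
and `f = P_t φ`, then `|∇ₓ f|²/f ≤ ∂ₜ f + (n/(2t)) f`. -/
theorem li_yau_heat_semigroup
    (n : ℕ) (hn : 1 ≤ n)
    (φ : EuclideanSpace ℝ (Fin n) → ℝ)
    (hφc : Continuous φ) (hφb : ∃ M, ∀ x, |φ x| ≤ M) (hφ0 : ∀ x, 0 ≤ φ x)
    (f : EuclideanSpace ℝ (Fin n) → ℝ → ℝ)
    (hf : ∀ x t, f x t = ∫ y : EuclideanSpace ℝ (Fin n),
      (4 * π * t) ^ (-(n : ℝ) / 2) * Real.exp (-‖x - y‖ ^ 2 / (4 * t)) * φ y)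
    (x : EuclideanSpace ℝ (Fin n)) (t : ℝ) (ht : 0 < t) :
    ‖gradient (fun x' => f x' t) x‖ ^ 2 / f x t
      ≤ deriv (fun t' => f x t') t + ((n : ℝ) / (2 * t)) * f x t := by
  obtain ⟨M, hM⟩ := hφb
  have hf' : ∀ x t, f x t = (4 * π * t) ^ (-(n : ℝ) / 2) *
      ∫ y, Real.exp (-‖x - y‖ ^ 2 / (4 * t)) * φ y := by
    intro x t
    rw [hf, ← integral_const_mul]
    simp only [mul_assoc]
  obtain ⟨hCi, hD⟩ := ly_time φ hφc M hM x t ht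
  have hS := ly_space φ hφc M hM x t ht
  have hAi := ly_int0 φ hφc M hM x t ht
  simp only [hf']
  set c := (4 * π * t) ^ (-(n : ℝ) / 2) with hc
  have hc0 : 0 < c := by positivity
  set A := ∫ y, Real.exp (-‖x - y‖ ^ 2 / (4 * t)) * φ y with hAdef
  set C := ∫ y, Real.exp (-‖x - y‖ ^ 2 / (4 * t)) * (‖x - y‖ ^ 2 / (4 * t ^ 2)) * φ y with hCdef
  have hA0 : 0 ≤ A := integral_nonneg fun y => mul_nonneg (Real.exp_nonneg _) (hφ0 y)
  have hC0 : 0 ≤ C := integral_nonneg fun y => mul_nonneg (by positivity) (hφ0 y)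
  -- time derivative
  have hpow : HasDerivAt (fun s : ℝ => (4 * π * s) ^ (-(n : ℝ) / 2)) (-(n / (2 * t)) * c) t := by
    have h1 : HasDerivAt (fun s : ℝ => 4 * π * s) (4 * π) t := by
      simpa using (hasDerivAt_id t).const_mul (4 * π)
    have h2 := h1.rpow_const (p := -(n : ℝ) / 2) (Or.inl (by positivity))
    convert h2 using 1
    rw [Real.rpow_sub_one (by positivity), ← hc]
    field_simp
  have hd : deriv (fun s => (4 * π * s) ^ (-(n : ℝ) / 2) *
      ∫ y, Real.exp (-‖x - y‖ ^ 2 / (4 * s)) * φ y) t = -(n / (2 * t)) * c * A + c * C :=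
    (hpow.mul hD).deriv
  rw [hd]
  -- gradient
  set B := ∫ y, Real.exp (-‖x - y‖ ^ 2 / (4 * t)) * (‖x - y‖ / (2 * t)) * φ y with hBdef
  have hg : ‖gradient (fun x' => c * ∫ y, Real.exp (-‖x' - y‖ ^ 2 / (4 * t)) * φ y) x‖ ≤ c * B := by
    rw [gradient, LinearIsometryEquiv.norm_map, (hS.const_mul c).fderiv, norm_smul,
      Real.norm_eq_abs, abs_of_pos hc0]
    refine mul_le_mul_of_nonneg_left ((norm_integral_le_integral_norm _).trans (le_of_eq ?_)) hc0.le
    refine integral_congr_ae (Filter.Eventually.of_forall fun y => ?_)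
    simp only
    rw [norm_smul, innerSL_apply_norm, norm_mul, norm_mul, norm_neg, Real.norm_eq_abs,
      Real.norm_eq_abs, Real.norm_eq_abs, Real.abs_exp, abs_of_nonneg (hφ0 y),
      abs_of_nonneg (by positivity : 0 ≤ 1 / (2 * t))]
    ring
  have hBi : Integrable (fun y => Real.exp (-‖x - y‖ ^ 2 / (4 * t)) * (‖x - y‖ / (2 * t)) * φ y) := by
    refine (hAi.add hCi).mono' (by fun_prop) (Filter.Eventually.of_forall fun y => ?_)
    have h0 := hφ0 y
    rw [Real.norm_eq_abs, abs_of_nonneg (by positivity)]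
    have : ‖x - y‖ / (2 * t) ≤ 1 + ‖x - y‖ ^ 2 / (4 * t ^ 2) := by
      have e : ‖x - y‖ ^ 2 / (4 * t ^ 2) = (‖x - y‖ / (2 * t)) ^ 2 := by rw [div_pow]; ring
      rw [e]
      nlinarith [sq_nonneg (‖x - y‖ / (2 * t) - 1), sq_nonneg (‖x - y‖ / (2 * t))]
    calc _ ≤ Real.exp (-‖x - y‖ ^ 2 / (4 * t)) * (1 + ‖x - y‖ ^ 2 / (4 * t ^ 2)) * φ y := by gcongr
      _ = _ := by simp only [Pi.add_apply]; ring
  have hcs : B ^ 2 / A ≤ C := by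
    refine ly_cs A B C hA0 hC0 fun s => ?_
    have : C - 2 * s * B + s ^ 2 * A = ∫ y, (Real.exp (-‖x - y‖ ^ 2 / (4 * t)) *
        (‖x - y‖ / (2 * t) - s) ^ 2 * φ y) := by
      rw [hAdef, hBdef, hCdef, ← integral_const_mul, ← integral_const_mul,
        ← integral_sub hCi (hBi.const_mul _)]
      refine (integral_add (hCi.sub (hBi.const_mul _)) (hAi.const_mul _)).symm.trans ?_
      refine integral_congr_ae (Filter.Eventually.of_forall fun y => ?_)
      have e : ‖x - y‖ ^ 2 / (4 * t ^ 2) = (‖x - y‖ / (2 * t)) ^ 2 := by rw [div_pow]; ring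
      simp only [e, Pi.sub_apply]
      ring
    rw [this]
    exact integral_nonneg fun y => mul_nonneg (by positivity) (hφ0 y)
  calc _ ≤ (c * B) ^ 2 / (c * A) := by gcongr
    _ = c * (B ^ 2 / A) := by rw [mul_pow, pow_two c, mul_assoc, mul_div_mul_left _ _ hc0.ne',
          mul_div_assoc]
    _ ≤ c * C := by gcongr
    _ = _ := by ring
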